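/- arXiv:1712.08454 — 2 statements merged into one kernel-verified Lean document; each statement's English description precedes it below -/
import Mathlib

section
/- Suppose w is a real-analytic solution near the origin in ℝ² of an elliptic equation a₁₁ w_{x₁x₁} + 2a₁₂ w_{x₁x₂} + a₂₂ w_{x₂x₂} + b₁ w_{x₁} + b₂ w_{x₂} = 0 with analytic coefficients satisfying a₁₂² - a₁₁a₂₂ < 0, and suppose w vanishes at the origin to order exactly k ≥ 1 (i.e., its Taylor expansion starts with a nonzero homogeneous polynomial P_k of degree k). If the equation takes the canonical form (∂²/∂ξ² + ∂²/∂η² + b₁'∂/∂ξ + b₂'∂/∂η)w = 0 in suitable coordinates, then the lowest order Taylor polynomial P_k is a harmonic homogeneous polynomial, i.e., P_k(ξ,η) = Re(ρ(ξ+iη)^k) for some complex number ρ ≠ 0. -/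
open Filter Topology Asymptotics
open scoped ContDiff

section Homogeneous

variable {E F : Type*} [NormedAddCommGroup E] [NormedSpace ℝ E]
  [NormedAddCommGroup F] [NormedSpace ℝ F]

/-- A homogeneous function of degree `k` which is `o(‖x‖ ^ k)` at the origin vanishes. -/
theorem eq_zero_of_homogeneous_of_isLittleO {k : ℕ} {Q : E → ℝ}
    (hQ : ∀ (c : ℝ) (x : E), Q (c • x) = c ^ k * Q x)
    (ho : Q =o[𝓝 0] fun x => ‖x‖ ^ k) (x : E) : Q x = 0 := by
  have key : ∀ ε > 0, |Q x| ≤ ε * ‖x‖ ^ k := by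
    intro ε hε
    have hlim : Tendsto (fun t : ℝ => t • x) (𝓝[≠] 0) (𝓝 0) := by
      have : Continuous fun t : ℝ => t • x := by fun_prop
      simpa using (this.tendsto 0).mono_left nhdsWithin_le_nhds
    obtain ⟨t, ht, ht0⟩ :=
      ((hlim.eventually (ho.def hε)).and self_mem_nhdsWithin).exists
    have ht1 : 0 < |t| ^ k := pow_pos (abs_pos.2 ht0) k
    rw [hQ, norm_mul, norm_pow, norm_pow, norm_norm, norm_smul, mul_pow, Real.norm_eq_abs,
      Real.norm_eq_abs] at ht
    refine le_of_mul_le_mul_left (a := |t| ^ k) ?_ ht1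
    linarith
  by_contra hne
  have hpos : 0 < |Q x| := abs_pos.2 hne
  have h2 := key (|Q x| / (2 * (‖x‖ ^ k + 1))) (by positivity)
  rw [div_mul_eq_mul_div, le_div_iff₀ (by positivity)] at h2
  nlinarith [pow_nonneg (norm_nonneg x) k]

/-- If an analytic function is `O(‖x‖ ^ n)` at the origin, then the diagonal values of the terms
of order less than `n` in its power series vanish. -/
theorem HasFPowerSeriesAt.apply_diag_eq_zero_of_isBigO {f : E → F}
    {p : FormalMultilinearSeries ℝ E F} (hp : HasFPowerSeriesAt f p 0) {n : ℕ}
    (hf : f =O[𝓝 0] fun x => ‖x‖ ^ n) (m : ℕ) (hm : m < n) (y : E) :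
    (p m fun _ => y) = 0 := by
  induction m using Nat.strong_induction_on generalizing y with
  | _ m ih =>
    refine Asymptotics.IsBigO.continuousMultilinearMap_apply_eq_zero ?_ y
    have h1 := hp.isBigO_sub_partialSum_pow (m + 1)
    have h2 : f =O[𝓝 0] fun x => ‖x‖ ^ (m + 1) :=
      by
      rcases (Nat.succ_le_of_lt hm).eq_or_lt with h | h
      · simpa [← h] using hf
      · exact hf.trans (isLittleO_norm_pow_norm_pow h).isBigO
    have h3 := h2.sub h1
    refine h3.congr_left fun x => ?_
    rw [zero_add, sub_sub_cancel, FormalMultilinearSeries.partialSum, Finset.sum_range_succ,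
      Finset.sum_eq_zero, zero_add]
    intro j hj
    have hj' := Finset.mem_range.1 hj
    exact ih j hj' (hj'.trans hm) x

/-- The derivative of an analytic function which is `O(‖x‖ ^ (n + 1))` is `O(‖x‖ ^ n)`. -/
theorem AnalyticAt.fderiv_isBigO_pow [CompleteSpace F] {f : E → F} (hf : AnalyticAt ℝ f 0) {n : ℕ}
    (hO : f =O[𝓝 0] fun x => ‖x‖ ^ (n + 1)) :
    fderiv ℝ f =O[𝓝 0] fun x => ‖x‖ ^ n := by
  obtain ⟨p, r, hp⟩ := hf
  let q : FormalMultilinearSeries ℝ E F := fun m => if m ≤ n then 0 else p m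
  have hq : HasFPowerSeriesOnBall f q 0 r := by
    refine ⟨hp.r_le.trans (FormalMultilinearSeries.radius_le_of_le fun m => ?_), hp.r_pos, ?_⟩
    · by_cases h : m ≤ n <;> simp [q, h]
    · intro y hy
      convert hp.hasSum hy using 2 with m
      by_cases h : m ≤ n
      · simp [q, h, hp.hasFPowerSeriesAt.apply_diag_eq_zero_of_isBigO hO m
          (Nat.lt_succ_of_le h) y]
      · simp [q, h]
  have h := hq.fderiv.hasFPowerSeriesAt.isBigO_sub_partialSum_pow n
  refine h.congr_left fun x => ?_
  rw [zero_add, FormalMultilinearSeries.partialSum, Finset.sum_eq_zero, sub_zero]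
  intro j hj
  rw [FormalMultilinearSeries.derivSeries_eq_zero]
  · simp
  · simp [q, Nat.succ_le_of_lt (Finset.mem_range.1 hj)]

theorem AnalyticAt.fderiv_apply [CompleteSpace F] {f : E → F} {x : E} (hf : AnalyticAt ℝ f x)
    (e : E) : AnalyticAt ℝ (fun y => fderiv ℝ f y e) x :=
  ((ContinuousLinearMap.apply ℝ F e).analyticAt _).comp hf.fderiv

/-- A homogeneous function of degree `k` which is bounded near the origin is `O(‖x‖ ^ k)`. -/
theorem isBigO_norm_pow_of_homogeneous {k : ℕ} {P : E → ℝ}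
    (hP : ∀ (c : ℝ) (x : E), P (c • x) = c ^ k * P x)
    (hb : P =O[𝓝 0] fun _ => (1 : ℝ)) : P =O[𝓝 0] fun x => ‖x‖ ^ k := by
  obtain ⟨C, hC⟩ := hb.bound
  obtain ⟨δ, hδ, hball⟩ := Metric.eventually_nhds_iff_ball.1 hC
  refine IsBigO.of_bound (C * (2 / δ) ^ k) (Eventually.of_forall fun x => ?_)
  by_cases hx : x = 0
  · subst hx
    have h0 := hball 0 (by simpa using hδ)
    rcases Nat.eq_zero_or_pos k with rfl | hk
    · simpa using h0
    · have := hP 0 0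
      simp only [smul_zero, zero_pow hk.ne', zero_mul] at this
      simp [this, hk.ne']
  have hx' : 0 < ‖x‖ := norm_pos_iff.2 hx
  have hy := hball ((δ / 2 / ‖x‖) • x) (by
    rw [mem_ball_zero_iff, norm_smul, Real.norm_of_nonneg (by positivity),
      div_mul_cancel₀ _ hx'.ne']
    linarith)
  have hxy : x = (2 / δ * ‖x‖) • ((δ / 2 / ‖x‖) • x) := by
    rw [smul_smul, show 2 / δ * ‖x‖ * (δ / 2 / ‖x‖) = 1 by field_simp, one_smul]
  conv_lhs => rw [hxy, hP]
  rw [norm_mul, norm_pow, Real.norm_of_nonneg (by positivity : 0 ≤ 2 / δ * ‖x‖),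
    norm_pow, norm_norm, mul_pow]
  rw [norm_one, mul_one] at hy
  have := mul_le_mul_of_nonneg_left hy (by positivity : 0 ≤ (2 / δ) ^ k * ‖x‖ ^ k)
  linarith

/-- The homogeneous leading term of an analytic function is the diagonal of the corresponding
term of its power series. -/
theorem HasFPowerSeriesAt.eq_apply_diag_of_homogeneous {k : ℕ} {w P : E → ℝ}
    {p : FormalMultilinearSeries ℝ E ℝ} (hp : HasFPowerSeriesAt w p 0)
    (hP : ∀ (c : ℝ) (x : E), P (c • x) = c ^ k * P x)
    (hT : (fun x => w x - P x) =o[𝓝 0] fun x => ‖x‖ ^ k) (x : E) :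
    P x = p k fun _ => x := by
  have hone : (fun x : E => ‖x‖ ^ k) =O[𝓝 0] fun _ => (1 : ℝ) := by
    have : Continuous fun x : E => ‖x‖ ^ k := by fun_prop
    exact this.continuousAt.isBigO_one ℝ
  have hwb : w =O[𝓝 0] fun _ => (1 : ℝ) := hp.continuousAt.isBigO_one ℝ
  have hPO : P =O[𝓝 0] fun x => ‖x‖ ^ k := by
    refine isBigO_norm_pow_of_homogeneous hP ?_
    exact (hwb.sub (hT.isBigO.trans hone)).congr_left fun x => by ring
  have hwO : w =O[𝓝 0] fun x => ‖x‖ ^ k :=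
    (hT.isBigO.add hPO).congr_left fun x => by ring
  have h1 := hp.isBigO_sub_partialSum_pow (k + 1)
  have h2 : (fun x => w x - p k fun _ => x) =o[𝓝 0] fun x => ‖x‖ ^ k := by
    have h3 : (fun x : E => ‖x‖ ^ (k + 1)) =o[𝓝 0] fun x => ‖x‖ ^ k :=
      isLittleO_norm_pow_norm_pow (Nat.lt_succ_self k)
    refine (h1.trans_isLittleO h3).congr_left fun x => ?_
    rw [zero_add, FormalMultilinearSeries.partialSum, Finset.sum_range_succ,
      Finset.sum_eq_zero, zero_add]
    intro j hj
    exact hp.apply_diag_eq_zero_of_isBigO hwO j (Finset.mem_range.1 hj) x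
  have h4 := eq_zero_of_homogeneous_of_isLittleO (k := k)
    (Q := fun x => P x - p k fun _ => x) (fun c x => ?_)
    ((h2.sub hT).congr_left fun x => by ring) x
  · linarith
  · have := (p k).map_smul_univ (fun _ => c) (fun _ => x)
    simp only [Finset.prod_const, Finset.card_univ, Fintype.card_fin, smul_eq_mul] at this
    rw [hP, this]
    ring

theorem ContDiff.fderiv_fderiv_apply {P : E → ℝ} (hP : ContDiff ℝ 2 P) (x e e' : E) :
    fderiv ℝ (fun y => fderiv ℝ P y e') x e = fderiv ℝ (fderiv ℝ P) x e e' := by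
  have hd : DifferentiableAt ℝ (fderiv ℝ P) x :=
    ((hP.fderiv_right (m := 1) (by norm_num)).differentiable (by norm_num)) x
  rw [fderiv_clm_apply hd (differentiableAt_const e')]
  simp

theorem fderiv_smul_of_homogeneous {k : ℕ} {P : E → ℝ} (hP : Differentiable ℝ P)
    (hom : ∀ (c : ℝ) (x : E), P (c • x) = c ^ k * P x) (c : ℝ) (x e : E) :
    c * fderiv ℝ P (c • x) e = c ^ k * fderiv ℝ P x e := by
  have h1 : HasFDerivAt (fun y => P (c • y))
      ((fderiv ℝ P (c • x)).comp (c • ContinuousLinearMap.id ℝ E)) x :=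
    (hP (c • x)).hasFDerivAt.comp x ((hasFDerivAt_id x).const_smul c)
  have h2 : HasFDerivAt (fun y => P (c • y)) (c ^ k • fderiv ℝ P x) x := by
    simp only [hom]
    exact (hP x).hasFDerivAt.const_mul (c ^ k)
  simpa using congrArg (fun L => L e) (h1.unique h2)

theorem fderiv_fderiv_smul_of_homogeneous {k : ℕ} {P : E → ℝ} (hP : ContDiff ℝ 2 P)
    (hom : ∀ (c : ℝ) (x : E), P (c • x) = c ^ k * P x) (c : ℝ) (x e e' : E) :
    c ^ 2 * fderiv ℝ (fun y => fderiv ℝ P y e') (c • x) e =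
      c ^ k * fderiv ℝ (fun y => fderiv ℝ P y e') x e := by
  have hd : Differentiable ℝ fun y => fderiv ℝ P y e' :=
    ((hP.fderiv_right (m := 1) (by norm_num)).differentiable (by norm_num)).clm_apply
      (differentiable_const e')
  have h1 : HasFDerivAt (fun y => c * fderiv ℝ P (c • y) e')
      (c • (fderiv ℝ (fun y => fderiv ℝ P y e') (c • x)).comp
        (c • ContinuousLinearMap.id ℝ E)) x :=
    ((hd (c • x)).hasFDerivAt.comp x ((hasFDerivAt_id x).const_smul c)).const_mul c
  have h2 : HasFDerivAt (fun y => c * fderiv ℝ P (c • y) e')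
      (c ^ k • fderiv ℝ (fun y => fderiv ℝ P y e') x) x := by
    simp only [fderiv_smul_of_homogeneous (hP.differentiable (by norm_num)) hom]
    exact (hd x).hasFDerivAt.const_mul (c ^ k)
  have := congrArg (fun L => L e) (h1.unique h2)
  simp only [_root_.smul_apply, ContinuousLinearMap.comp_apply,
    ContinuousLinearMap.id_apply, map_smul, smul_eq_mul] at this
  linarith

/-- Euler's identity for homogeneous functions. -/
theorem fderiv_apply_self_of_homogeneous {k : ℕ} {P : E → ℝ} (hP : Differentiable ℝ P)
    (hom : ∀ (c : ℝ) (x : E), P (c • x) = c ^ k * P x) (x : E) :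
    fderiv ℝ P x x = k * P x := by
  have h1 : HasDerivAt (fun c : ℝ => P (c • x)) (fderiv ℝ P ((1 : ℝ) • x) ((1 : ℝ) • x)) 1 :=
    (hP ((1 : ℝ) • x)).hasFDerivAt.comp_hasDerivAt (1 : ℝ) ((hasDerivAt_id (1 : ℝ)).smul_const x)
  have h2 : HasDerivAt (fun c : ℝ => P (c • x)) (k * P x) 1 := by
    simp only [hom]
    simpa using (hasDerivAt_pow k (1 : ℝ)).mul_const (P x)
  simpa using h1.unique h2

/-- Euler's identity for the derivative of a homogeneous function. -/
theorem fderiv_fderiv_apply_self_of_homogeneous {k : ℕ} {P : E → ℝ} (hP : ContDiff ℝ 2 P)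
    (hom : ∀ (c : ℝ) (x : E), P (c • x) = c ^ k * P x) (x e : E) :
    fderiv ℝ (fderiv ℝ P) x e x = (k - 1) * fderiv ℝ P x e := by
  have hd : DifferentiableAt ℝ (fderiv ℝ P) x :=
    ((hP.fderiv_right (m := 1) (by norm_num)).differentiable (by norm_num)) x
  have hP1 : Differentiable ℝ P := hP.differentiable (by norm_num)
  have h1 := hd.hasFDerivAt.clm_apply (hasFDerivAt_id x)
  have h2 : HasFDerivAt (fun y => fderiv ℝ P y y) ((k : ℝ) • fderiv ℝ P x) x := by
    simp only [fderiv_apply_self_of_homogeneous hP1 hom]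
    exact (hP1 x).hasFDerivAt.const_mul (k : ℝ)
  have := congrArg (fun L => L e) (h1.unique h2)
  simp at this
  linarith

end Homogeneous

/-- Solutions of `h'' = -k² h` are combinations of `cos kθ` and `sin kθ`. -/
theorem eq_cos_add_sin_of_hasDerivAt {κ : ℝ} (hκ : κ ≠ 0) {h h' : ℝ → ℝ}
    (hh : ∀ θ, HasDerivAt h (h' θ) θ) (hh' : ∀ θ, HasDerivAt h' (-κ ^ 2 * h θ) θ) (θ : ℝ) :
    h θ = h 0 * Real.cos (κ * θ) + h' 0 / κ * Real.sin (κ * θ) := by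
  have hc : ∀ θ, HasDerivAt (fun θ => Real.cos (κ * θ)) (-Real.sin (κ * θ) * κ) θ := fun θ => by
    simpa using ((hasDerivAt_id θ).const_mul κ).cos
  have hs : ∀ θ, HasDerivAt (fun θ => Real.sin (κ * θ)) (Real.cos (κ * θ) * κ) θ := fun θ => by
    simpa using ((hasDerivAt_id θ).const_mul κ).sin
  let u : ℝ → ℝ := fun θ => h θ * Real.cos (κ * θ) - h' θ / κ * Real.sin (κ * θ)
  let v : ℝ → ℝ := fun θ => h θ * Real.sin (κ * θ) + h' θ / κ * Real.cos (κ * θ)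
  have hu : ∀ θ, HasDerivAt u 0 θ := fun θ => by
    convert! ((hh θ).mul (hc θ)).sub (((hh' θ).div_const κ).mul (hs θ)) using 1
    field_simp
    ring
  have hv : ∀ θ, HasDerivAt v 0 θ := fun θ => by
    convert! ((hh θ).mul (hs θ)).add (((hh' θ).div_const κ).mul (hc θ)) using 1
    field_simp
    ring
  have hu0 : u θ = h 0 := by
    rw [is_const_of_deriv_eq_zero (fun θ => (hu θ).differentiableAt) (fun θ => (hu θ).deriv) θ 0]
    simp [u]
  have hv0 : v θ = h' 0 / κ := by
    rw [is_const_of_deriv_eq_zero (fun θ => (hv θ).differentiableAt) (fun θ => (hv θ).deriv) θ 0]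
    simp [v]
  rw [← hu0, ← hv0]
  simp only [u, v]
  linear_combination (-h θ) * Real.sin_sq_add_cos_sq (κ * θ)

/-- A harmonic homogeneous function of degree `k` on the plane is the real part of `ρ z ^ k`. -/
theorem exists_re_mul_pow_of_harmonic {k : ℕ} (hk : 1 ≤ k) {P : ℝ × ℝ → ℝ} (hP : ContDiff ℝ 2 P)
    (hom : ∀ (c : ℝ) (x : ℝ × ℝ), P (c • x) = c ^ k * P x)
    (hlap : ∀ x : ℝ × ℝ, x ≠ 0 → fderiv ℝ (fun y => fderiv ℝ P y (1, 0)) x (1, 0) +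
      fderiv ℝ (fun y => fderiv ℝ P y (0, 1)) x (0, 1) = 0) :
    ∃ ρ : ℂ, ∀ ξ η : ℝ, P (ξ, η) = (ρ * (ξ + η * Complex.I) ^ k).re := by
  have hP1 : Differentiable ℝ P := hP.differentiable (by norm_num)
  have hP2 : Differentiable ℝ (fderiv ℝ P) :=
    (hP.fderiv_right (m := 1) (by norm_num)).differentiable (by norm_num)
  have hk0 : (k : ℝ) ≠ 0 := by positivity
  let γ : ℝ → ℝ × ℝ := fun θ => (Real.cos θ, Real.sin θ)
  let ν : ℝ → ℝ × ℝ := fun θ => (-Real.sin θ, Real.cos θ)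
  have hγ : ∀ θ, HasDerivAt γ (ν θ) θ := fun θ =>
    (Real.hasDerivAt_cos θ).prodMk (Real.hasDerivAt_sin θ)
  have hν : ∀ θ, HasDerivAt ν (-γ θ) θ := fun θ =>
    (Real.hasDerivAt_sin θ).neg.prodMk (Real.hasDerivAt_cos θ)
  have hh : ∀ θ, HasDerivAt (fun θ => P (γ θ)) (fderiv ℝ P (γ θ) (ν θ)) θ := fun θ =>
    (hP1 (γ θ)).hasFDerivAt.comp_hasDerivAt θ (hγ θ)
  have hh' : ∀ θ, HasDerivAt (fun θ => fderiv ℝ P (γ θ) (ν θ)) (-(k : ℝ) ^ 2 * P (γ θ)) θ := by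
    intro θ
    have h1 : HasDerivAt (fun θ => fderiv ℝ P (γ θ)) (fderiv ℝ (fderiv ℝ P) (γ θ) (ν θ)) θ :=
      (hP2 (γ θ)).hasFDerivAt.comp_hasDerivAt θ (hγ θ)
    have h2 := h1.clm_apply (hν θ)
    convert! h2 using 1
    have hne : γ θ ≠ 0 := fun h0 => by
      have hc : Real.cos θ = 0 := congrArg Prod.fst h0
      have hs : Real.sin θ = 0 := congrArg Prod.snd h0
      simpa [hc, hs] using Real.sin_sq_add_cos_sq θ
    have hl := hlap _ hne
    rw [hP.fderiv_fderiv_apply, hP.fderiv_fderiv_apply] at hl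
    have e1 := fderiv_apply_self_of_homogeneous hP1 hom (γ θ)
    have e2 := fderiv_fderiv_apply_self_of_homogeneous hP hom (γ θ) (γ θ)
    have eγ : γ θ = Real.cos θ • ((1, 0) : ℝ × ℝ) + Real.sin θ • ((0, 1) : ℝ × ℝ) := by
      simp [γ]
    have eν : ν θ = (-Real.sin θ) • ((1, 0) : ℝ × ℝ) + Real.cos θ • ((0, 1) : ℝ × ℝ) := by
      simp [ν]
    generalize fderiv ℝ (fderiv ℝ P) (γ θ) = B at *
    have hB : B (ν θ) (ν θ) = -B (γ θ) (γ θ) := by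
      rw [eγ, eν]
      simp only [map_add, map_smul, _root_.add_apply, _root_.smul_apply,
        smul_eq_mul]
      linear_combination (Real.sin θ ^ 2 + Real.cos θ ^ 2) * hl
    rw [hB, map_neg, e2, e1]
    ring
  let a : ℝ := P (γ 0)
  let b : ℝ := fderiv ℝ P (γ 0) (ν 0) / k
  refine ⟨⟨a, -b⟩, fun ξ η => ?_⟩
  set z : ℂ := ξ + η * Complex.I with hz
  have hpol := Complex.norm_mul_cos_arg z
  have hpol' := Complex.norm_mul_sin_arg z
  have hre : z.re = ξ := by simp [hz]
  have him : z.im = η := by simp [hz]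
  have hsol := eq_cos_add_sin_of_hasDerivAt hk0 hh hh' z.arg
  have hpt : ((ξ, η) : ℝ × ℝ) = ‖z‖ • γ z.arg := by
    simp [γ, hpol, hpol', hre, him]
  have hzk : z ^ k = ((‖z‖ ^ k : ℝ) : ℂ) *
      (Real.cos (k * z.arg) + Real.sin (k * z.arg) * Complex.I) := by
    conv_lhs => rw [← Complex.norm_mul_cos_add_sin_mul_I z, mul_pow]
    rw [Complex.cos_add_sin_mul_I_pow]
    push_cast
    rfl
  rw [hpt, hom, hsol, hzk]
  simp only [Complex.mul_re, Complex.mul_im, Complex.ofReal_re, Complex.ofReal_im, Complex.add_re,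
    Complex.add_im, Complex.I_re, Complex.I_im]
  simp only [a, b]
  ring

theorem stmt_8 (k : ℕ) (hk : 1 ≤ k)
    (U : Set (ℝ × ℝ)) (hUo : IsOpen U) (hU0 : (0 : ℝ × ℝ) ∈ U)
    (w b₁' b₂' : ℝ × ℝ → ℝ)
    (hw : AnalyticOnNhd ℝ w U)
    (hb₁ : AnalyticOnNhd ℝ b₁' U) (hb₂ : AnalyticOnNhd ℝ b₂' U)
    (Dw : (ℝ × ℝ) → (ℝ × ℝ) → ℝ)
    (hDw : ∀ x e, Dw x e = fderiv ℝ w x e)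
    (D2w : (ℝ × ℝ) → (ℝ × ℝ) → (ℝ × ℝ) → ℝ)
    (hD2w : ∀ x e e', D2w x e e' = fderiv ℝ (fun y => fderiv ℝ w y e') x e)
    (heq : ∀ x ∈ U,
      D2w x (1, 0) (1, 0) + D2w x (0, 1) (0, 1) +
        b₁' x * Dw x (1, 0) + b₂' x * Dw x (0, 1) = 0)
    (P : ℝ × ℝ → ℝ)
    (hPhom : ∀ (c : ℝ) (x : ℝ × ℝ), P (c • x) = c ^ k * P x)
    (hPne : P ≠ 0)
    (hTaylor : (fun x => w x - P x) =o[nhds (0 : ℝ × ℝ)] fun x => ‖x‖ ^ k) :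
    ∃ ρ : ℂ, ρ ≠ 0 ∧ ∀ ξ η : ℝ,
      P (ξ, η) = (ρ * (ξ + η * Complex.I) ^ k).re := by
  obtain ⟨n, rfl⟩ : ∃ n, k = n + 1 := ⟨k - 1, by omega⟩
  have hw0 : AnalyticAt ℝ w 0 := hw 0 hU0
  obtain ⟨p, hp⟩ := hw 0 hU0
  have hPp : P = fun x => p (n + 1) fun _ => x :=
    funext fun x => hp.eq_apply_diag_of_homogeneous hPhom hTaylor x
  have hPω : ContDiff ℝ ω P := by
    rw [hPp]
    exact (p (n + 1)).contDiff.comp (contDiff_pi.2 fun _ => contDiff_id)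
  have hP2 : ContDiff ℝ 2 P := hPω.of_le le_top
  have hPan : ∀ x, AnalyticAt ℝ P x := fun x => hPω.contDiffAt.analyticAt
  have hPb : P =O[𝓝 0] fun x => ‖x‖ ^ (n + 1) :=
    isBigO_norm_pow_of_homogeneous hPhom ((hPan 0).continuousAt.isBigO_one ℝ)
  have hwO : w =O[𝓝 0] fun x => ‖x‖ ^ (n + 1) :=
    (hTaylor.isBigO.add hPb).congr_left fun x => by ring
  have hran : AnalyticAt ℝ (fun x => w x - P x) 0 := hw0.sub (hPan 0)
  have hrO : (fun x => w x - P x) =O[𝓝 0] fun x => ‖x‖ ^ (n + 1 + 1) := by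
    refine (hp.isBigO_sub_partialSum_pow (n + 1 + 1)).congr_left fun x => ?_
    rw [zero_add, FormalMultilinearSeries.partialSum, Finset.sum_range_succ,
      Finset.sum_eq_zero, zero_add, hPp]
    exact fun j hj => hp.apply_diag_eq_zero_of_isBigO hwO j (Finset.mem_range.1 hj) x
  have hDwO : ∀ e, (fun x => fderiv ℝ w x e) =O[𝓝 0] fun x => ‖x‖ ^ n := fun e =>
    ((ContinuousLinearMap.apply ℝ ℝ e).isBigO_comp _ _).trans (hw0.fderiv_isBigO_pow hwO)
  have hDrO : ∀ e, (fun x => fderiv ℝ (fun x => w x - P x) x e) =O[𝓝 0]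
      fun x => ‖x‖ ^ (n + 1) := fun e =>
    ((ContinuousLinearMap.apply ℝ ℝ e).isBigO_comp _ _).trans (hran.fderiv_isBigO_pow hrO)
  have hD2rO : ∀ e e', (fun x => fderiv ℝ (fun y => fderiv ℝ (fun x => w x - P x) y e') x e)
      =O[𝓝 0] fun x => ‖x‖ ^ n := fun e e' =>
    ((ContinuousLinearMap.apply ℝ ℝ e).isBigO_comp _ _).trans
      ((hran.fderiv_apply e').fderiv_isBigO_pow (hDrO e'))
  have hsub : ∀ x ∈ U, ∀ e e', fderiv ℝ (fun y => fderiv ℝ P y e') x e =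
      D2w x e e' - fderiv ℝ (fun y => fderiv ℝ (fun x => w x - P x) y e') x e := by
    intro x hx e e'
    have hev : (fun y => fderiv ℝ (fun x => w x - P x) y e') =ᶠ[𝓝 x]
        fun y => fderiv ℝ w y e' - fderiv ℝ P y e' := by
      filter_upwards [hUo.mem_nhds hx] with y hy
      rw [fderiv_fun_sub (hw y hy).differentiableAt (hPan y).differentiableAt]
      rfl
    rw [hev.fderiv_eq, fderiv_fun_sub
      ((hw x hx).fderiv_apply e').differentiableAt
      ((hPan x).fderiv_apply e').differentiableAt, hD2w]
    simp
  let L : ℝ × ℝ → ℝ := fun x => fderiv ℝ (fun y => fderiv ℝ P y (1, 0)) x (1, 0) +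
    fderiv ℝ (fun y => fderiv ℝ P y (0, 1)) x (0, 1)
  have hLO : L =O[𝓝 0] fun x => ‖x‖ ^ n := by
    have hb : ∀ b : ℝ × ℝ → ℝ, AnalyticOnNhd ℝ b U → ∀ e,
        (fun x => b x * fderiv ℝ w x e) =O[𝓝 0] fun x => ‖x‖ ^ n := fun b hb e => by
      simpa using ((hb 0 hU0).continuousAt.isBigO_one ℝ).mul (hDwO e)
    refine ((((hD2rO (1, 0) (1, 0)).add (hD2rO (0, 1) (0, 1))).add
      (hb b₁' hb₁ (1, 0))).add (hb b₂' hb₂ (0, 1))).neg_left.congr' ?_ EventuallyEq.rfl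
    filter_upwards [hUo.mem_nhds hU0] with x hx
    have h := heq x hx
    rw [hDw, hDw] at h
    simp only [L, hsub x hx]
    linarith
  have hL : ∀ x, ‖x‖ ^ 2 * L x = 0 := by
    refine eq_zero_of_homogeneous_of_isLittleO (k := n + 1) (fun c x => ?_) ?_
    · have h1 := fderiv_fderiv_smul_of_homogeneous hP2 hPhom c x (1, 0) (1, 0)
      have h2 := fderiv_fderiv_smul_of_homogeneous hP2 hPhom c x (0, 1) (0, 1)
      rw [norm_smul, mul_pow, Real.norm_eq_abs, sq_abs]
      simp only [L]
      linear_combination ‖x‖ ^ 2 * (h1 + h2)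
    · have h1 : (fun x => ‖x‖ ^ 2 * L x) =O[𝓝 0] fun x => ‖x‖ ^ 2 * ‖x‖ ^ n :=
        (isBigO_refl _ _).mul hLO
      simp only [← pow_add] at h1
      exact h1.trans_isLittleO (isLittleO_norm_pow_norm_pow (by omega))
  obtain ⟨ρ, hρ⟩ := exists_re_mul_pow_of_harmonic hk hP2 hPhom fun x hx =>
    (mul_eq_zero.1 (hL x)).resolve_left (pow_ne_zero 2 (norm_ne_zero_iff.2 hx))
  refine ⟨ρ, ?_, hρ⟩
  rintro rfl
  exact hPne (funext fun x => by simpa using hρ x.1 x.2)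
end

section
/- Let w : Ω → ℝ be a C² function on a planar domain Ω, analytic, satisfying a second-order linear elliptic equation Lw = a₁₁w_{x₁x₁} + 2a₁₂w_{x₁x₂} + a₂₂w_{x₂x₂} + b₁w_{x₁} + b₂w_{x₂} = 0 with analytic coefficients and a₁₂² − a₁₁a₂₂ < 0. If w is not constant, then every interior critical point of w is isolated in the critical set {x ∈ Ω : ∇w(x) = 0}. -/
open Filter Topology Asymptotics

/-- Leading-order asymptotics of an analytic function whose derivatives of order less than `m`
vanish at `p`, along points `p + r • y` with `r → 0` and `y` convergent. -/
lemma AnalyticAt.tendsto_inv_pow_smul {E F ι : Type*} [NormedAddCommGroup E] [NormedSpace ℝ E]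
    [NormedAddCommGroup F] [NormedSpace ℝ F] [CompleteSpace F] {f : E → F} {p : E}
    (hf : AnalyticAt ℝ f p) {m : ℕ} (hm : ∀ k < m, iteratedFDeriv ℝ k f p = 0)
    {l : Filter ι} {r : ι → ℝ} {y : ι → E} {v : E} (hr : Tendsto r l (𝓝 0))
    (hr0 : ∀ᶠ i in l, r i ≠ 0) (hy : Tendsto y l (𝓝 v)) :
    Tendsto (fun i => (r i ^ m)⁻¹ • f (p + r i • y i)) l
      (𝓝 ((m.factorial : ℝ)⁻¹ • iteratedFDeriv ℝ m f p fun _ => v)) := by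
  obtain ⟨q, R, hq⟩ := hf
  have hdiag : ∀ k z, (q k fun _ => z) =
      (k.factorial : ℝ)⁻¹ • iteratedFDeriv ℝ k f p fun _ => z := by
    intro k z
    rw [← hq.factorial_smul z k, ← Nat.cast_smul_eq_nsmul ℝ, smul_smul,
      inv_mul_cancel₀ (by positivity), one_smul]
  have hsum : ∀ z, q.partialSum (m + 1) z = q m fun _ => z := by
    intro z
    rw [FormalMultilinearSeries.partialSum, Finset.sum_range_succ, Finset.sum_eq_zero, zero_add]
    intro k hk
    rw [hdiag, hm k (Finset.mem_range.mp hk)]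
    simp
  have hry : Tendsto (fun i => r i • y i) l (𝓝 0) := by simpa using hr.smul hy
  have hO := (hq.hasFPowerSeriesAt.isBigO_sub_partialSum_pow (m + 1)).comp_tendsto hry
  have hO' : (fun i => f (p + r i • y i) - q m fun _ => r i • y i) =O[l]
      fun i => r i ^ (m + 1) := by
    refine (hO.congr_left fun i => ?_).trans ?_
    · simp [hsum]
    · have h1 : (fun i => r i • y i) =O[l] r := by
        simpa using (isBigO_refl r l).smul (hy.isBigO_one ℝ)
      exact (h1.norm_left.pow (m + 1))
  have hlim : Tendsto (fun i => (r i ^ m)⁻¹ • (f (p + r i • y i) - q m fun _ => r i • y i)) l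
      (𝓝 0) := by
    have h2 := (isBigO_refl (fun i => (r i ^ m)⁻¹) l).smul hO'
    refine h2.trans_tendsto (hr.congr' ?_)
    filter_upwards [hr0] with i hi
    rw [smul_eq_mul, pow_succ, inv_mul_cancel_left₀ (pow_ne_zero _ hi)]
  have hmain : Tendsto (fun i => q m fun _ => y i) l (𝓝 (q m fun _ => v)) :=
    ((q m).cont.tendsto _).comp (tendsto_pi_nhds.2 fun _ => hy)
  rw [← hdiag, ← zero_add (q m fun _ => v)]
  refine (hlim.add hmain).congr' ?_
  filter_upwards [hr0] with i hi
  have h3 := (q m).map_smul_univ (fun _ => r i) (fun _ => y i)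
  rw [h3, smul_sub, smul_smul]
  simp [inv_mul_cancel₀ (pow_ne_zero m hi)]

/-- An analytic function all of whose derivatives of positive order vanish at a point is
locally constant there. -/
lemma AnalyticAt.eventually_eq_of_iteratedFDeriv_eq_zero {E F : Type*} [NormedAddCommGroup E]
    [NormedSpace ℝ E] [NormedAddCommGroup F] [NormedSpace ℝ F] [CompleteSpace F] {f : E → F}
    {p : E} (hf : AnalyticAt ℝ f p) (h : ∀ k, iteratedFDeriv ℝ (k + 1) f p = 0) :
    ∀ᶠ x in 𝓝 p, f x = f p := by
  obtain ⟨q, R, hq⟩ := hf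
  filter_upwards [Metric.eball_mem_nhds p hq.r_pos] with x hx
  have hx' : x - p ∈ Metric.eball (0 : E) R := by
    simpa [edist_eq_enorm_sub] using hx
  have hs := hq.hasSum_iteratedFDeriv hx'
  rw [add_sub_cancel] at hs
  refine hs.unique ?_
  convert hasSum_single 0 ?_
  · simp
  · intro k hk
    obtain ⟨j, rfl⟩ := Nat.exists_eq_succ_of_ne_zero hk
    simp [h j]

/-- A symmetric multilinear map vanishing on the diagonal is zero. -/
lemma ContinuousMultilinearMap.eq_zero_of_diag_eq_zero {E F : Type*} [NormedAddCommGroup E]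
    [NormedSpace ℝ E] [NormedAddCommGroup F] [NormedSpace ℝ F] {n : ℕ}
    (A : ContinuousMultilinearMap ℝ (fun _ : Fin n => E) F)
    (hsymm : ∀ (x : Fin n → E) (σ : Equiv.Perm (Fin n)), A (x ∘ σ) = A x)
    (hdiag : ∀ y, (A fun _ => y) = 0) : A = 0 := by
  ext x
  have h := A.iteratedFDeriv_comp_diagonal 0 x
  have hz : (fun y => A fun _ => y) = fun _ => (0 : F) := funext hdiag
  have hsum : ∑ σ : Equiv.Perm (Fin n), (A fun i => x (σ i)) = (n.factorial : ℝ) • A x := by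
    have hσ : ∀ σ : Equiv.Perm (Fin n), (A fun i => x (σ i)) = A x := hsymm x
    simp [hσ, Fintype.card_perm, Nat.cast_smul_eq_nsmul]
  rw [hz, hsum, iteratedFDeriv_fun_zero] at h
  simpa [Nat.factorial_ne_zero] using h.symm

lemma sq_add_sq_pos_of_mk_ne_zero {v₁ v₂ : ℝ} (hv : (v₁, v₂) ≠ 0) : 0 < v₁ ^ 2 + v₂ ^ 2 := by
  by_contra hcon
  apply hv
  have h1 : v₁ = 0 := by nlinarith [sq_nonneg v₁, sq_nonneg v₂]
  have h2 : v₂ = 0 := by nlinarith [sq_nonneg v₁, sq_nonneg v₂]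
  simp [h1, h2]

/-- A bilinear form on the plane annihilated by an elliptic operator and vanishing whenever one
argument is `v` and the other is `v` or its rotation also vanishes on the rotation of `v`. -/
lemma bilin_rotation_eq_zero_of_elliptic {a b c v₁ v₂ : ℝ} (hell : b ^ 2 - a * c < 0)
    (hv : (v₁, v₂) ≠ 0) (B : ℝ × ℝ →L[ℝ] ℝ × ℝ →L[ℝ] ℝ)
    (hvv : B (v₁, v₂) (v₁, v₂) = 0) (hvu : B (v₁, v₂) (-v₂, v₁) = 0)
    (huv : B (-v₂, v₁) (v₁, v₂) = 0)
    (hB : a * B (1, 0) (1, 0) + 2 * b * B (1, 0) (0, 1) + c * B (0, 1) (0, 1) = 0) :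
    B (-v₂, v₁) (-v₂, v₁) = 0 := by
  have hexp : ∀ x y : ℝ × ℝ, B x y = x.1 * y.1 * B (1, 0) (1, 0) + x.1 * y.2 * B (1, 0) (0, 1)
      + x.2 * y.1 * B (0, 1) (1, 0) + x.2 * y.2 * B (0, 1) (0, 1) := by
    intro x y
    have hd : ∀ z : ℝ × ℝ, z = z.1 • ((1 : ℝ), (0 : ℝ)) + z.2 • ((0 : ℝ), (1 : ℝ)) := by
      intro z; ext <;> simp
    conv_lhs => rw [hd x, hd y]
    simp only [map_add, map_smul, add_apply, smul_apply,
      smul_eq_mul]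
    ring
  have hq : a * v₂ ^ 2 - 2 * b * (v₁ * v₂) + c * v₁ ^ 2 ≠ 0 := by
    intro h0
    have ha : a ≠ 0 := by rintro rfl; nlinarith [sq_nonneg b]
    have h1 : (a * v₂ - b * v₁) ^ 2 + (a * c - b ^ 2) * v₁ ^ 2 = 0 := by
      linear_combination a * h0
    have h2 : v₁ = 0 := by
      by_contra hne
      have : 0 < v₁ ^ 2 := by positivity
      nlinarith [sq_nonneg (a * v₂ - b * v₁)]
    have h3 : v₂ = 0 := by
      rw [h2] at h1
      simpa [ha] using h1
    exact hv (by simp [h2, h3])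
  rw [hexp] at hvv hvu huv ⊢
  simp only at hvv hvu huv ⊢
  refine (mul_eq_zero.mp ?_).resolve_left hq
  linear_combination (v₁ ^ 2 + v₂ ^ 2) ^ 2 * hB - (a * v₁ ^ 2 + 2 * b * v₁ * v₂ + c * v₂ ^ 2) * hvv
    - (-a * v₁ * v₂ + 2 * b * v₁ ^ 2 + c * v₁ * v₂) * hvu
    - (-a * v₁ * v₂ - 2 * b * v₂ ^ 2 + c * v₁ * v₂) * huv

/-- A multilinear form on the plane, each of whose two-slot restrictions is annihilated by a fixed
elliptic operator, is zero as soon as it vanishes when all but one of its arguments equal some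
nonzero `v`. -/
lemma multilinear_eq_zero_of_elliptic {a b c : ℝ} (hell : b ^ 2 - a * c < 0) {v : ℝ × ℝ}
    (hv : v ≠ 0) {n : ℕ} [NeZero n] (T : ContinuousMultilinearMap ℝ (fun _ : Fin n => ℝ × ℝ) ℝ)
    (hT : ∀ i x, (∀ j, j ≠ i → x j = v) → T x = 0)
    (hB : ∀ i j x, i ≠ j → ∃ B : ℝ × ℝ →L[ℝ] ℝ × ℝ →L[ℝ] ℝ,
      (∀ s t, T (Function.update (Function.update x i s) j t) = B s t) ∧
      a * B (1, 0) (1, 0) + 2 * b * B (1, 0) (0, 1) + c * B (0, 1) (0, 1) = 0) :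
    T = 0 := by
  obtain ⟨v₁, v₂⟩ := v
  set v : ℝ × ℝ := (v₁, v₂) with hvdef
  set u : ℝ × ℝ := (-v₂, v₁) with hudef
  have key : ∀ s : Finset (Fin n), T (s.piecewise (fun _ => u) (fun _ => v)) = 0 := by
    intro s
    induction s using Finset.strongInduction with
    | H s ih =>
      by_cases hs : 1 < s.card
      · obtain ⟨i, hi, j, hj, hij⟩ := Finset.one_lt_card.mp hs
        obtain ⟨B, hB1, hB2⟩ := hB i j (s.piecewise (fun _ => u) (fun _ => v)) hij
        have hpw : ∀ (s' : Finset (Fin n)) (p q : ℝ × ℝ),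
            (∀ k, k ≠ i → k ≠ j → (k ∈ s' ↔ k ∈ s)) → (p = if i ∈ s' then u else v) →
            (q = if j ∈ s' then u else v) →
            B p q = T (s'.piecewise (fun _ => u) (fun _ => v)) := by
          intro s' p q h hp hq
          rw [← hB1]
          congr 1
          ext1 k
          by_cases hkj : k = j
          · subst hkj; simp [Finset.piecewise, hq]
          · by_cases hki : k = i
            · subst hki; simp [Finset.piecewise, hp, hkj]
            · simp [Finset.piecewise, hkj, hki, h k hki hkj]
        rw [← hpw s u u (by simp) (by simp [hi]) (by simp [hj])]
        refine bilin_rotation_eq_zero_of_elliptic hell hv B ?_ ?_ ?_ hB2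
        · rw [hpw ((s.erase i).erase j) v v (by simp +contextual) (by simp) (by simp)]
          exact ih _ ((Finset.erase_subset _ _).trans_ssubset (Finset.erase_ssubset hi))
        · rw [hpw (s.erase i) v u (by simp +contextual) (by simp) (by simp [hj, hij.symm])]
          exact ih _ (Finset.erase_ssubset hi)
        · rw [hpw (s.erase j) u v (by simp +contextual) (by simp [hi, hij]) (by simp)]
          exact ih _ (Finset.erase_ssubset hj)
      · obtain ⟨i, hi⟩ : ∃ i, s ⊆ {i} := Finset.card_le_one_iff_subset_singleton.mp (not_lt.mp hs)
        refine hT i _ fun j hj => Finset.piecewise_eq_of_notMem _ _ _ fun hjs => hj ?_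
        simpa using hi hjs
  have hN : v₁ ^ 2 + v₂ ^ 2 ≠ 0 := (sq_add_sq_pos_of_mk_ne_zero hv).ne'
  ext x
  set α : Fin n → ℝ := fun i => (v₁ * (x i).2 - v₂ * (x i).1) / (v₁ ^ 2 + v₂ ^ 2)
  set β : Fin n → ℝ := fun i => (v₁ * (x i).1 + v₂ * (x i).2) / (v₁ ^ 2 + v₂ ^ 2)
  have hx : x = (fun i => α i • u) + fun i => β i • v := by
    ext i
    · simp only [α, β, u, v, Pi.add_apply, Prod.fst_add, Prod.smul_fst, smul_eq_mul]
      field_simp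
      ring
    · simp only [α, β, u, v, Pi.add_apply, Prod.snd_add, Prod.smul_snd, smul_eq_mul]
      field_simp
      ring
  rw [hx, T.map_add_univ]
  refine Finset.sum_eq_zero fun s _ => ?_
  have hs : s.piecewise (fun i => α i • u) (fun i => β i • v) =
      fun i => s.piecewise α β i • s.piecewise (fun _ => u) (fun _ => v) i := by
    ext1 i
    by_cases hi : i ∈ s <;> simp [hi]
  rw [hs, T.map_smul_univ, key s, smul_zero]

/-- A permutation sending two given distinct points to two given distinct points. -/
lemma Equiv.Perm.exists_apply_eq_and_apply_eq {α : Type*} [DecidableEq α] {s t i j : α}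
    (hst : s ≠ t) (hij : i ≠ j) : ∃ σ : Equiv.Perm α, σ s = i ∧ σ t = j := by
  refine ⟨(Equiv.swap s i).trans (Equiv.swap (Equiv.swap s i t) j), ?_, ?_⟩
  · have h : i ≠ Equiv.swap s i t := by
      rw [Ne, eq_comm, Equiv.swap_apply_eq_iff, Equiv.swap_apply_right]
      exact hst.symm
    simp [Equiv.swap_apply_of_ne_of_ne h hij]
  · simp

/-- Accumulation of zeros of an analytic function at `p` forces its leading homogeneous part
to vanish at some nonzero vector. -/
lemma AnalyticAt.exists_ne_zero_iteratedFDeriv_diag_eq_zero {E F : Type*} [NormedAddCommGroup E]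
    [NormedSpace ℝ E] [ProperSpace E] [NormedAddCommGroup F] [NormedSpace ℝ F] [CompleteSpace F]
    {f : E → F} {p : E} (hf : AnalyticAt ℝ f p) {m : ℕ}
    (hm : ∀ k < m, iteratedFDeriv ℝ k f p = 0) (hz : ∃ᶠ x in 𝓝[≠] p, f x = 0) :
    ∃ v ≠ 0, (iteratedFDeriv ℝ m f p fun _ => v) = 0 := by
  obtain ⟨x, hx, hfx⟩ := exists_seq_forall_of_frequently hz
  rw [tendsto_nhdsWithin_iff] at hx
  obtain ⟨hxp, hne⟩ := hx
  have hr : Tendsto (fun k => ‖x k - p‖) atTop (𝓝 0) :=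
    tendsto_iff_norm_sub_tendsto_zero.mp hxp
  have hr0 : ∀ᶠ k in atTop, ‖x k - p‖ ≠ 0 := by
    filter_upwards [hne] with k hk
    simpa [sub_eq_zero] using hk
  have hsphere : ∃ᶠ k in atTop, ‖x k - p‖⁻¹ • (x k - p) ∈ Metric.sphere (0 : E) 1 := by
    refine Eventually.frequently ?_
    filter_upwards [hr0] with k hk
    simp [norm_smul, hk]
  obtain ⟨v, hv, φ, hφ, hlim⟩ := (isCompact_sphere (0 : E) 1).tendsto_subseq' hsphere
  refine ⟨v, ne_zero_of_mem_unit_sphere ⟨v, hv⟩, ?_⟩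
  have ht := hf.tendsto_inv_pow_smul hm (hr.comp hφ.tendsto_atTop)
    (hφ.tendsto_atTop.eventually hr0) hlim
  have h0 : Tendsto (fun k => ((‖x (φ k) - p‖ ^ m)⁻¹ : ℝ) • f (x (φ k))) atTop (𝓝 0) := by
    simp [hfx]
  have hlim0 := tendsto_nhds_unique (ht.congr' ?_) h0
  · simpa [Nat.factorial_ne_zero] using hlim0
  · filter_upwards [hφ.tendsto_atTop.eventually hr0] with k hk
    simp [smul_smul, mul_inv_cancel₀ hk]

/-- The leading part of the Hessian of a solution is annihilated by the principal part of the
operator, with coefficients frozen at the point. -/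
lemma iteratedFDeriv_hessian_elliptic {a b c b₁ b₂ w : ℝ × ℝ → ℝ} {p : ℝ × ℝ}
    (ha : ContinuousAt a p) (hb : ContinuousAt b p) (hc : ContinuousAt c p)
    (hb₁ : ContinuousAt b₁ p) (hb₂ : ContinuousAt b₂ p) (hw : AnalyticAt ℝ w p)
    (heq : ∀ᶠ x in 𝓝 p, a x * fderiv ℝ (fderiv ℝ w) x (1, 0) (1, 0)
      + 2 * b x * fderiv ℝ (fderiv ℝ w) x (1, 0) (0, 1)
      + c x * fderiv ℝ (fderiv ℝ w) x (0, 1) (0, 1)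
      + b₁ x * fderiv ℝ w x (1, 0) + b₂ x * fderiv ℝ w x (0, 1) = 0)
    {m : ℕ} (hm : ∀ k < m + 1, iteratedFDeriv ℝ k (fderiv ℝ w) p = 0) (z : Fin m → ℝ × ℝ) :
    a p * iteratedFDeriv ℝ m (fderiv ℝ (fderiv ℝ w)) p z (1, 0) (1, 0)
      + 2 * b p * iteratedFDeriv ℝ m (fderiv ℝ (fderiv ℝ w)) p z (1, 0) (0, 1)
      + c p * iteratedFDeriv ℝ m (fderiv ℝ (fderiv ℝ w)) p z (0, 1) (0, 1) = 0 := by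
  set H := fderiv ℝ (fderiv ℝ w) with hH
  set ev : ℝ × ℝ → ℝ × ℝ → ((ℝ × ℝ →L[ℝ] ℝ × ℝ →L[ℝ] ℝ) →L[ℝ] ℝ) := fun e e' =>
    (ContinuousLinearMap.apply ℝ ℝ e').comp (ContinuousLinearMap.apply ℝ (ℝ × ℝ →L[ℝ] ℝ) e)
  set L : (ℝ × ℝ →L[ℝ] ℝ × ℝ →L[ℝ] ℝ) →L[ℝ] ℝ :=
    a p • ev (1, 0) (1, 0) + (2 * b p) • ev (1, 0) (0, 1) + c p • ev (0, 1) (0, 1)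
  have hLapp : ∀ B, L B = a p * B (1, 0) (1, 0) + 2 * b p * B (1, 0) (0, 1)
      + c p * B (0, 1) (0, 1) := fun B => by simp [L, ev]
  have hHan : AnalyticAt ℝ H p := hw.fderiv.fderiv
  have hHm : ∀ k < m, iteratedFDeriv ℝ k H p = 0 := fun k hk => by
    rw [← norm_eq_zero, hH, norm_iteratedFDeriv_fderiv, hm (k + 1) (by omega), norm_zero]
  have hzero : L.compContinuousMultilinearMap (iteratedFDeriv ℝ m H p) = 0 := by
    refine ContinuousMultilinearMap.eq_zero_of_diag_eq_zero _ (fun x σ => ?_) fun y => ?_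
    · simp only [ContinuousLinearMap.compContinuousMultilinearMap_coe, Function.comp_apply]
      rw [hHan.contDiffAt.iteratedFDeriv_comp_perm]
    · have hr : Tendsto (fun t : ℝ => t) (𝓝[≠] 0) (𝓝 0) := nhdsWithin_le_nhds
      have hr0 : ∀ᶠ t : ℝ in 𝓝[≠] 0, t ≠ 0 := self_mem_nhdsWithin
      have hy : Tendsto (fun _ : ℝ => y) (𝓝[≠] 0) (𝓝 y) := tendsto_const_nhds
      have hpt : Tendsto (fun t : ℝ => p + t • y) (𝓝[≠] 0) (𝓝 p) := by
        simpa using (tendsto_const_nhds (x := p)).add (hr.smul hy)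
      have hHlim := hHan.tendsto_inv_pow_smul hHm hr hr0 hy
      have hglim := hw.fderiv.tendsto_inv_pow_smul (m := m) (fun k hk => hm k (by omega)) hr hr0 hy
      rw [hm m (by omega)] at hglim
      have hHe := fun e e' : ℝ × ℝ => ((ev e e').continuous.tendsto _).comp hHlim
      have hge := fun e : ℝ × ℝ =>
        ((ContinuousLinearMap.apply ℝ ℝ e).continuous.tendsto _).comp hglim
      have hsum := (((((ha.tendsto.comp hpt).mul (hHe (1, 0) (1, 0))).add
        (((hb.tendsto.comp hpt).const_mul 2).mul (hHe (1, 0) (0, 1)))).add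
        ((hc.tendsto.comp hpt).mul (hHe (0, 1) (0, 1)))).add
        ((hb₁.tendsto.comp hpt).mul (hge (1, 0)))).add
        ((hb₂.tendsto.comp hpt).mul (hge (0, 1)))
      have hlim := tendsto_nhds_unique (hsum.congr' (f₂ := fun _ => 0) ?_) tendsto_const_nhds
      · have hfac : (m.factorial : ℝ) ≠ 0 := by positivity
        simp only [ev, ContinuousLinearMap.comp_apply, ContinuousLinearMap.apply_apply,
          smul_apply, smul_eq_mul, zero_apply, smul_zero, map_zero,
          mul_zero, add_zero] at hlim
        simp only [ContinuousLinearMap.compContinuousMultilinearMap_coe, Function.comp_apply,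
          hLapp]
        field_simp at hlim
        linear_combination hlim
      · filter_upwards [hpt.eventually heq] with t ht
        simp only [ev, Function.comp_apply, ContinuousLinearMap.comp_apply,
          ContinuousLinearMap.apply_apply, smul_apply, smul_eq_mul]
        linear_combination (t ^ m)⁻¹ * ht
  have hz := congrArg (fun A => A z) hzero
  simpa [hLapp] using hz

theorem stmt_17 (Ω : Set (ℝ × ℝ)) (hΩo : IsOpen Ω) (hΩc : IsPreconnected Ω)
    (a11 a12 a22 b1 b2 w : ℝ × ℝ → ℝ)
    (ha11 : AnalyticOnNhd ℝ a11 Ω) (ha12 : AnalyticOnNhd ℝ a12 Ω)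
    (ha22 : AnalyticOnNhd ℝ a22 Ω) (hb1 : AnalyticOnNhd ℝ b1 Ω)
    (hb2 : AnalyticOnNhd ℝ b2 Ω) (hw : AnalyticOnNhd ℝ w Ω)
    (hell : ∀ x ∈ Ω, a12 x ^ 2 - a11 x * a22 x < 0)
    (D : (ℝ × ℝ) → (ℝ × ℝ) → ℝ)
    (hD : ∀ x e, D x e = fderiv ℝ w x e)
    (D2 : (ℝ × ℝ) → (ℝ × ℝ) → (ℝ × ℝ) → ℝ)
    (hD2 : ∀ x e e', D2 x e e' = fderiv ℝ (fun y => fderiv ℝ w y e') x e)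
    (heq : ∀ x ∈ Ω,
      a11 x * D2 x (1, 0) (1, 0) + 2 * a12 x * D2 x (1, 0) (0, 1) +
        a22 x * D2 x (0, 1) (0, 1) + b1 x * D x (1, 0) + b2 x * D x (0, 1) = 0)
    (hnc : ¬ ∃ c : ℝ, ∀ x ∈ Ω, w x = c) :
    ∀ p ∈ Ω, fderiv ℝ w p = 0 →
      ∃ V ∈ nhds p, ∀ x ∈ V ∩ Ω, x ≠ p → fderiv ℝ w x ≠ 0 := by
  intro p hp hcrit
  have hwp := hw p hp
  have hD2' : ∀ x ∈ Ω, ∀ e e', D2 x e e' = fderiv ℝ (fderiv ℝ w) x e e' := by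
    intro x hx e e'
    rw [hD2, fderiv_clm_apply (hw x hx).fderiv.differentiableAt (differentiableAt_const e')]
    simp
  have hex : ∃ k, iteratedFDeriv ℝ (k + 1) w p ≠ 0 := by
    by_contra! hall
    refine hnc ⟨w p, fun x hx => ?_⟩
    exact hw.eqOn_of_preconnected_of_eventuallyEq analyticOnNhd_const hΩc hp
      (hwp.eventually_eq_of_iteratedFDeriv_eq_zero hall) hx
  classical
  obtain ⟨n, hn, hmin⟩ : ∃ n, iteratedFDeriv ℝ (n + 1) w p ≠ 0 ∧
      ∀ k < n, iteratedFDeriv ℝ (k + 1) w p = 0 :=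
    ⟨Nat.find hex, Nat.find_spec hex, fun k hk => not_not.mp (Nat.find_min hex hk)⟩
  obtain ⟨m, rfl⟩ : ∃ m, n = m + 1 := by
    refine Nat.exists_eq_succ_of_ne_zero ?_
    rintro rfl
    refine hn ?_
    rw [← norm_eq_zero, zero_add, norm_iteratedFDeriv_one, hcrit, norm_zero]
  have hm : ∀ k < m + 1, iteratedFDeriv ℝ k (fderiv ℝ w) p = 0 := fun k hk => by
    rw [← norm_eq_zero, norm_iteratedFDeriv_fderiv, hmin k hk, norm_zero]
  by_contra hcon
  have hfreq : ∃ᶠ x in 𝓝[≠] p, fderiv ℝ w x = 0 := by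
    intro hev
    obtain ⟨V, hV, hVsub⟩ := mem_nhdsWithin_iff_exists_mem_nhds_inter.mp hev
    exact hcon ⟨V, hV, fun x hx hxp => hVsub ⟨hx.1, hxp⟩⟩
  obtain ⟨v, hv, hTv⟩ := hwp.fderiv.exists_ne_zero_iteratedFDeriv_diag_eq_zero hm hfreq
  have hperm : ∀ (x : Fin (m + 1 + 1) → ℝ × ℝ) (σ : Equiv.Perm (Fin (m + 1 + 1))),
      iteratedFDeriv ℝ (m + 1 + 1) w p (x ∘ σ) = iteratedFDeriv ℝ (m + 1 + 1) w p x :=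
    fun x σ => hwp.contDiffAt.iteratedFDeriv_comp_perm x σ
  refine hn (multilinear_eq_zero_of_elliptic (hell p hp) hv _ ?_ ?_)
  · intro i x hx
    rw [← hperm x (Equiv.swap i (Fin.last _)), iteratedFDeriv_succ_apply_right]
    have hinit : Fin.init (x ∘ Equiv.swap i (Fin.last _)) = fun _ => v := by
      ext1 k
      refine hx _ fun h => (Fin.castSucc_lt_last k).ne ?_
      rw [Equiv.swap_apply_eq_iff, Equiv.swap_apply_left] at h
      exact h
    rw [hinit, hTv]
    rfl
  · intro i j x hij
    obtain ⟨σ, hσi, hσj⟩ := Equiv.Perm.exists_apply_eq_and_apply_eq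
      (Fin.castSucc_lt_last (Fin.last m)).ne hij
    refine ⟨iteratedFDeriv ℝ m (fderiv ℝ (fderiv ℝ w)) p (Fin.init (Fin.init (x ∘ σ))), ?_, ?_⟩
    · intro s t
      rw [← hperm _ σ, iteratedFDeriv_succ_apply_right, iteratedFDeriv_succ_apply_right]
      have hinit : Fin.init (Fin.init (Function.update (Function.update x i s) j t ∘ σ)) =
          Fin.init (Fin.init (x ∘ σ)) := by
        ext1 k
        have hki : σ k.castSucc.castSucc ≠ i := by
          rw [← hσi, σ.injective.ne_iff]
          exact fun h => (Fin.castSucc_lt_last k).ne (Fin.castSucc_injective _ h)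
        have hkj : σ k.castSucc.castSucc ≠ j := by
          rw [← hσj, σ.injective.ne_iff]
          exact (Fin.castSucc_lt_last _).ne
        simp [Fin.init, hki, hkj]
      rw [hinit]
      simp [Fin.init, hσi, hσj, hij]
    · refine iteratedFDeriv_hessian_elliptic (ha11 p hp).continuousAt (ha12 p hp).continuousAt
        (ha22 p hp).continuousAt (hb1 p hp).continuousAt (hb2 p hp).continuousAt hwp ?_ hm _
      filter_upwards [hΩo.mem_nhds hp] with x hx
      simpa only [hD2' x hx, hD] using heq x hx
end
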